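/- In 𝒟_n the following q-commutation relations hold. (a) For 1 ≤ i < j ≤ n and −j ≤ a < b ≤ j−1: (E_{i,j−1}^{↑a_+} w_j^a)(E_{i,j−1}^{↑b_+} w_j^b) = q^{−2} (E_{i,j−1}^{↑b_+} w_j^b)(E_{i,j−1}^{↑a_+} w_j^a). (b) For 1 ≤ i < j ≤ n and −θ(j) ≤ a < b ≤ θ(j)−1: (F_{i,j−1}^{↑a_+} m_{θ(j)}^a)(F_{i,j−1}^{↑b_+} m_{θ(j)}^b) = q^{−2} (F_{i,j−1}^{↑b_+} m_{θ(j)}^b)(F_{i,j−1}^{↑a_+} m_{θ(j)}^a). (c) For 1 ≤ i < j < k ≤ n and −j ≤ a < b ≤ j−1: (E_{i,j−1}^{↑a_+} w_j^a E_{j+1,k}^{↓a_−})(E_{i,j−1}^{↑b_+} w_j^b E_{j+1,k}^{↓b_−}) = q^{−2} (E_{i,j−1}^{↑b_+} w_j^b E_{j+1,k}^{↓b_−})(E_{i,j−1}^{↑a_+} w_j^a E_{j+1,k}^{↓a_−}). -/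

import Mathlib

noncomputable section

/-- The ground field `𝕂 = ℂ(q)`, the field of rational functions over `ℂ`. -/
abbrev Kq : Type := RatFunc ℂ

/-- The formal variable `q ∈ ℂ(q)`. -/
def qq : Kq := RatFunc.X

/-- `𝐢 = √−1 ∈ ℂ`, viewed as a constant in `𝕂 = ℂ(q)`. -/
def ii : Kq := RatFunc.C Complex.I

/-- `θ(i) = n + 1 − i`. -/
def th (n : ℕ) (i : ℤ) : ℤ := (n : ℤ) + 1 - i

/-- Labels for the vertices of the `𝒟ₙ`-quiver: `V i r` stands for `V_{i,r}`
(the canonical labels), and `C i` stands for the central vertex `Λ_{i,0}`. -/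
inductive DnLabel : Type
  | V : ℤ → ℤ → DnLabel
  | C : ℤ → DnLabel
deriving DecidableEq

/-- Validity of a label for given rank `n`: `V i r` requires `1 ≤ i ≤ n`, `−i ≤ r ≤ i`;
`C i` requires `1 ≤ i ≤ n`.  There are `n² + 3n` valid labels. -/
def DnLabel.valid (n : ℕ) : DnLabel → Prop
  | .V i r => 1 ≤ i ∧ i ≤ (n : ℤ) ∧ -i ≤ r ∧ r ≤ i
  | .C i => 1 ≤ i ∧ i ≤ (n : ℤ)

instance (n : ℕ) (v : DnLabel) : Decidable (v.valid n) := by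
  cases v <;> unfold DnLabel.valid <;> infer_instance

/-- The vertex set of the `𝒟ₙ`-quiver. -/
def DnVertex (n : ℕ) := {v : DnLabel // v.valid n}

/-- The canonical label of the vertex `Λ_{i,r}`, using the identifications
`Λ_{a,b} = V_{θ(b),−θ(a)}` for `b > 0` and `Λ_{a,b} = V_{θ(−b),θ(a)}` for `b < 0`. -/
def Lam (n : ℕ) (i r : ℤ) : DnLabel :=
  if 0 < r then .V (th n r) (-(th n i))
  else if r < 0 then .V (th n (-r)) (th n i)
  else .C i

/-- The list of arrows `(source, target, doubled weight)` of the `𝒟ₙ`-quiver, obtained by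
amalgamating two copies of the Fock–Goncharov `(n+1)`-triangle quiver along two pairs of
sides.  Solid (weight `1`) arrows get doubled weight `2`, dashed (weight `1/2`) arrows get
doubled weight `1`.  The families are: the horizontal `V_i`- and `Λ_i`-path arrows, the
dashed boundary arrows along the two frozen columns, and, for each `1 ≤ i < n`, the
oriented cycle `V_{i,0} → V_{i+1,−1} → ⋯ → V_{n,i−n} → Λ_{i,0} → V_{n,n−i} → ⋯ → V_{i+1,1} → V_{i,0}`
through the central column. -/
def dnArrows (n : ℕ) : List (DnLabel × DnLabel × ℤ) :=
  ((List.range n).flatMap fun i0 =>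
    (List.range (2 * i0 + 2)).map fun k =>
      (DnLabel.V ((i0 : ℤ) + 1) (-((i0 : ℤ) + 1) + k),
       DnLabel.V ((i0 : ℤ) + 1) (-((i0 : ℤ) + 1) + k + 1), 2))
  ++ ((List.range n).flatMap fun i0 =>
    (List.range (2 * i0 + 2)).map fun k =>
      (Lam n ((i0 : ℤ) + 1) (-((i0 : ℤ) + 1) + k),
       Lam n ((i0 : ℤ) + 1) (-((i0 : ℤ) + 1) + k + 1), 2))
  ++ ((List.range (n - 1)).map fun i0 =>
      (DnLabel.V ((i0 : ℤ) + 1) (-((i0 : ℤ) + 1)),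
       DnLabel.V ((i0 : ℤ) + 2) (-((i0 : ℤ) + 2)), 1))
  ++ ((List.range (n - 1)).map fun i0 =>
      (DnLabel.V ((i0 : ℤ) + 2) ((i0 : ℤ) + 2),
       DnLabel.V ((i0 : ℤ) + 1) ((i0 : ℤ) + 1), 1))
  ++ ((List.range (n - 1)).flatMap fun i0 =>
      (((List.range (n - 1 - i0)).map fun k =>
          (DnLabel.V ((i0 : ℤ) + 1 + k) (-(k : ℤ)),
           DnLabel.V ((i0 : ℤ) + 2 + k) (-(k : ℤ) - 1), 2))
        ++ [(DnLabel.V (n : ℤ) ((i0 : ℤ) + 1 - n), DnLabel.C ((i0 : ℤ) + 1), 2),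
            (DnLabel.C ((i0 : ℤ) + 1), DnLabel.V (n : ℤ) ((n : ℤ) - (i0 + 1)), 2)]
        ++ ((List.range (n - 1 - i0)).map fun k =>
          (DnLabel.V ((i0 : ℤ) + 2 + k) ((k : ℤ) + 1),
           DnLabel.V ((i0 : ℤ) + 1 + k) (k : ℤ), 2))))

/-- The doubled exchange matrix `2·ε_{uv}` of the `𝒟ₙ`-quiver. -/
def eps2 (n : ℕ) (u v : DnLabel) : ℤ :=
  ((dnArrows n).map fun a =>
    (if a.1 = u ∧ a.2.1 = v then a.2.2 else 0)
      - (if a.1 = v ∧ a.2.1 = u then a.2.2 else 0)).sum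

/-- The defining relations of the quantum torus algebra `𝒟ₙ`: generators `X_v^{±1}`
(`Sum.inl v` is `X_v`, `Sum.inr v` is `X_v⁻¹`) with `X_u X_v = q^{2 ε_{vu}} X_v X_u`. -/
inductive DnRel (n : ℕ) :
    FreeAlgebra Kq (DnVertex n ⊕ DnVertex n) →
      FreeAlgebra Kq (DnVertex n ⊕ DnVertex n) → Prop
  | comm (u v : DnVertex n) :
      DnRel n (FreeAlgebra.ι Kq (Sum.inl u) * FreeAlgebra.ι Kq (Sum.inl v))
        ((qq ^ eps2 n v.1 u.1) • (FreeAlgebra.ι Kq (Sum.inl v) * FreeAlgebra.ι Kq (Sum.inl u)))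
  | mul_inv (v : DnVertex n) :
      DnRel n (FreeAlgebra.ι Kq (Sum.inl v) * FreeAlgebra.ι Kq (Sum.inr v)) 1
  | inv_mul (v : DnVertex n) :
      DnRel n (FreeAlgebra.ι Kq (Sum.inr v) * FreeAlgebra.ι Kq (Sum.inl v)) 1

/-- The quantum torus algebra `𝒟ₙ`. -/
abbrev Dtorus (n : ℕ) := RingQuot (DnRel n)

/-- The cluster variable `X_v ∈ 𝒟ₙ` attached to a label (junk value `1` on invalid labels). -/
def Xg (n : ℕ) (v : DnLabel) : Dtorus n :=
  if h : v.valid n then RingQuot.mkAlgHom Kq (DnRel n) (FreeAlgebra.ι Kq (Sum.inl ⟨v, h⟩)) else 1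

/-- The inverse cluster variable `X_v⁻¹ ∈ 𝒟ₙ` (junk value `1` on invalid labels). -/
def Xinv (n : ℕ) (v : DnLabel) : Dtorus n :=
  if h : v.valid n then RingQuot.mkAlgHom Kq (DnRel n) (FreeAlgebra.ι Kq (Sum.inr ⟨v, h⟩)) else 1

/-- The ordered product `X_{V_{i,−i}} X_{V_{i,1−i}} ⋯ X_{V_{i,r}}`. -/
def Vprod (n : ℕ) (i r : ℤ) : Dtorus n :=
  ((List.range (r + i + 1).toNat).map fun k => Xg n (.V i (-i + k))).prod

/-- The ordered product `X_{Λ_{i,−i}} X_{Λ_{i,1−i}} ⋯ X_{Λ_{i,r}}`. -/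
def Lprod (n : ℕ) (i r : ℤ) : Dtorus n :=
  ((List.range (r + i + 1).toNat).map fun k => Xg n (Lam n i (-i + k))).prod

/-- `w_i^r = 𝐢 q^{i+r} X_{V_{i,−i}} X_{V_{i,1−i}} ⋯ X_{V_{i,r}}`. -/
def ww (n : ℕ) (i r : ℤ) : Dtorus n := (ii * qq ^ (i + r)) • Vprod n i r

/-- `m_i^r = 𝐢 q^{i+r} X_{Λ_{i,−i}} X_{Λ_{i,1−i}} ⋯ X_{Λ_{i,r}}`. -/
def mm (n : ℕ) (i r : ℤ) : Dtorus n := (ii * qq ^ (i + r)) • Lprod n i r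


/-- `E_i = Σ_{r=−i}^{i−1} w_i^r ∈ 𝒟ₙ`, the image of the Chevalley generator `E_i`. -/
def Ev (n : ℕ) (i : ℤ) : Dtorus n := ∑ r ∈ Finset.Icc (-i) (i - 1), ww n i r

/-- `F_j = Σ_{r=−θ(j)}^{θ(j)−1} m_{θ(j)}^r ∈ 𝒟ₙ`, the image of the Chevalley generator `F_j`. -/
def Fv (n : ℕ) (j : ℤ) : Dtorus n :=
  ∑ r ∈ Finset.Icc (-(th n j)) (th n j - 1), mm n (th n j) r

/-- Auxiliary recursion: `EEaux n i k = E_{i,i+k}`. -/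
def EEaux (n : ℕ) (i : ℤ) : ℕ → Dtorus n
  | 0 => Ev n i
  | k + 1 => (qq - qq⁻¹)⁻¹ •
      (EEaux n i k * Ev n (i + k + 1) - qq • (Ev n (i + k + 1) * EEaux n i k))

/-- The quantum root vector `E_{i,j}`, defined by `E_{i,i} = E_i` and
`E_{i,j} = (E_{i,j−1}E_j − qE_jE_{i,j−1})/(q−q^{−1})`. -/
def EE (n : ℕ) (i j : ℤ) : Dtorus n := EEaux n i (j - i).toNat

/-- Auxiliary recursion: `FFaux n i k = F_{i,i+k}`. -/
def FFaux (n : ℕ) (i : ℤ) : ℕ → Dtorus n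
  | 0 => Fv n i
  | k + 1 => (qq - qq⁻¹)⁻¹ •
      (Fv n (i + k + 1) * FFaux n i k - qq⁻¹ • (FFaux n i k * Fv n (i + k + 1)))

/-- The quantum root vector `F_{i,j}`, defined by `F_{i,i} = F_i` and
`F_{i,j} = (F_jF_{i,j−1} − q^{−1}F_{i,j−1}F_j)/(q−q^{−1})`. -/
def FF (n : ℕ) (i j : ℤ) : Dtorus n := FFaux n i (j - i).toNat

open Classical in
/-- The decomposition `x = x^− + x^+` with `y x^± = q^{±1} x^± y`; it is unique when it
exists (the first component is `x^−`, the second is `x^+`; junk value otherwise). -/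
def decompPM (n : ℕ) (y x : Dtorus n) : Dtorus n × Dtorus n :=
  if h : ∃ p : Dtorus n × Dtorus n,
      x = p.1 + p.2 ∧ y * p.1 = qq⁻¹ • (p.1 * y) ∧ y * p.2 = qq • (p.2 * y)
  then h.choose else (x, 0)

/-- The components `E_{i,j}^{↑s_∓}` of `E_{i,j}` with respect to `w_{j+1}^s`. -/
def Eup (n : ℕ) (i j s : ℤ) : Dtorus n × Dtorus n := decompPM n (ww n (j + 1) s) (EE n i j)

/-- The components `E_{i,j}^{↓r_∓}` of `E_{i,j}` with respect to `w_{i−1}^r`. -/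
def Edown (n : ℕ) (i j r : ℤ) : Dtorus n × Dtorus n := decompPM n (ww n (i - 1) r) (EE n i j)

/-- The components `F_{i,j}^{↑s_∓}` of `F_{i,j}` with respect to `m_{θ(j+1)}^s`. -/
def Fup (n : ℕ) (i j s : ℤ) : Dtorus n × Dtorus n :=
  decompPM n (mm n (th n (j + 1)) s) (FF n i j)

/-- The components `F_{i,j}^{↓r_∓}` of `F_{i,j}` with respect to `m_{θ(i−1)}^r`. -/
def Fdown (n : ℕ) (i j r : ℤ) : Dtorus n × Dtorus n :=
  decompPM n (mm n (th n (i - 1)) r) (FF n i j)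

/-! ### The exchange matrix -/

/-- The total doubled weight of the arrows `u → v` in a list of arrows. -/
def arrowWeight (L : List (DnLabel × DnLabel × ℤ)) (u v : DnLabel) : ℤ :=
  (L.map fun a => if a.1 = u ∧ a.2.1 = v then a.2.2 else 0).sum

lemma arrowWeight_append (L L' : List (DnLabel × DnLabel × ℤ)) (u v : DnLabel) :
    arrowWeight (L ++ L') u v = arrowWeight L u v + arrowWeight L' u v := by
  simp [arrowWeight]

lemma arrowWeight_pair (a b : DnLabel × DnLabel × ℤ) (u v : DnLabel) :
    arrowWeight [a, b] u v = (if a.1 = u ∧ a.2.1 = v then a.2.2 else 0) +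
      if b.1 = u ∧ b.2.1 = v then b.2.2 else 0 := by
  simp [arrowWeight]

lemma eps2_eq_arrowWeight_sub (n : ℕ) (u v : DnLabel) :
    eps2 n u v = arrowWeight (dnArrows n) u v - arrowWeight (dnArrows n) v u := by
  unfold eps2 arrowWeight
  induction dnArrows n with
  | nil => simp
  | cons a L ih => simp only [List.map_cons, List.sum_cons, ih]; ring

lemma arrowWeight_map_range (m : ℕ) (g : ℕ → DnLabel × DnLabel × ℤ) (u v : DnLabel) :
    arrowWeight ((List.range m).map g) u v =
      ∑ k ∈ Finset.range m, if (g k).1 = u ∧ (g k).2.1 = v then (g k).2.2 else 0 := by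
  induction m with
  | zero => simp [arrowWeight]
  | succ m ih =>
    rw [List.range_succ, List.map_append, arrowWeight_append, ih, Finset.sum_range_succ]
    simp [arrowWeight]

lemma arrowWeight_flatMap_range (m : ℕ) (F : ℕ → List (DnLabel × DnLabel × ℤ)) (u v : DnLabel) :
    arrowWeight ((List.range m).flatMap F) u v = ∑ i ∈ Finset.range m, arrowWeight (F i) u v := by
  induction m with
  | zero => simp [arrowWeight]
  | succ m ih =>
    rw [List.range_succ, List.flatMap_append, arrowWeight_append, ih, Finset.sum_range_succ]
    simp

lemma sum_range_ite_eq_ite {m : ℕ} {p : ℕ → Prop} [DecidablePred p] {Q : Prop} [Decidable Q]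
    {w : ℤ} (K : ℕ) (hK : ∀ k < m, p k → k = K) (hQ : Q ↔ K < m ∧ p K) :
    (∑ k ∈ Finset.range m, if p k then w else 0) = if Q then w else 0 := by
  split_ifs with hq
  · rw [hQ] at hq
    rw [Finset.sum_eq_single K, if_pos hq.2]
    · exact fun k hk hne => if_neg fun hc => hne (hK k (Finset.mem_range.1 hk) hc)
    · exact fun hK' => absurd (Finset.mem_range.2 hq.1) hK'
  · refine Finset.sum_eq_zero fun k hk => if_neg fun hc => hq ?_
    have hkm := Finset.mem_range.1 hk
    obtain rfl := hK k hkm hc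
    exact hQ.2 ⟨hkm, hc⟩

lemma sum_range_sum_range_ite_eq_ite {n : ℕ} {m : ℕ → ℕ} {p : ℕ → ℕ → Prop}
    [∀ i, DecidablePred (p i)] {Q : Prop} [Decidable Q] {w : ℤ} (I K : ℕ)
    (hK : ∀ i < n, ∀ k < m i, p i k → i = I ∧ k = K) (hQ : Q ↔ I < n ∧ K < m I ∧ p I K) :
    (∑ i ∈ Finset.range n, ∑ k ∈ Finset.range (m i), if p i k then w else 0) =
      if Q then w else 0 := by
  rw [← sum_range_ite_eq_ite (p := fun i => K < m i ∧ p i K) I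
    (fun i hi hp => (hK i hi K hp.1 hp.2).1) hQ]
  exact Finset.sum_congr rfl fun i hi => sum_range_ite_eq_ite K
    (fun k hk hp => (hK i (Finset.mem_range.1 hi) k hk hp).2) Iff.rfl

lemma Lam_eq_V_iff (n : ℕ) (i r a b : ℤ) :
    Lam n i r = .V a b ↔ 0 < r ∧ n + 1 - r = a ∧ -(n + 1 - i) = b ∨
      r < 0 ∧ n + 1 + r = a ∧ n + 1 - i = b := by
  unfold Lam th
  split_ifs <;> simp only [DnLabel.V.injEq, false_iff] <;> omega

lemma Lam_eq_C_iff (n : ℕ) (i r c : ℤ) : Lam n i r = .C c ↔ r = 0 ∧ i = c := by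
  unfold Lam th
  split_ifs <;> simp only [DnLabel.C.injEq, false_iff] <;> omega

lemma bind_pure_list_range (m : ℕ) :
    (do let a ← List.range m; pure (a : ℤ) : List ℤ) =
      List.map (fun a : ℕ => (a : ℤ)) (List.range m) :=
  List.map_eq_flatMap.symm

lemma arrowWeight_dnArrows (n : ℕ) (u v : DnLabel) :
    arrowWeight (dnArrows n) u v =
      (∑ i ∈ Finset.range n, ∑ k ∈ Finset.range (2 * i + 2),
        if DnLabel.V (i + 1) (-(i + 1) + k) = u ∧ DnLabel.V (i + 1) (-(i + 1) + k + 1) = v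
          then 2 else 0) +
      (∑ i ∈ Finset.range n, ∑ k ∈ Finset.range (2 * i + 2),
        if Lam n (i + 1) (-(i + 1) + k) = u ∧ Lam n (i + 1) (-(i + 1) + k + 1) = v
          then 2 else 0) +
      (∑ i ∈ Finset.range (n - 1),
        if DnLabel.V (i + 1) (-(i + 1)) = u ∧ DnLabel.V (i + 2) (-(i + 2)) = v
          then 1 else 0) +
      (∑ i ∈ Finset.range (n - 1),
        if DnLabel.V (i + 2) (i + 2) = u ∧ DnLabel.V (i + 1) (i + 1) = v then 1 else 0) +
      ((∑ i ∈ Finset.range (n - 1), ∑ k ∈ Finset.range (n - 1 - i),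
        if DnLabel.V (i + 1 + k) (-k) = u ∧ DnLabel.V (i + 2 + k) (-k - 1) = v
          then 2 else 0) +
      ((∑ i ∈ Finset.range (n - 1),
        if DnLabel.V n (i + 1 - n) = u ∧ DnLabel.C (i + 1) = v then 2 else 0) +
      (∑ i ∈ Finset.range (n - 1),
        if DnLabel.C (i + 1) = u ∧ DnLabel.V n (n - (i + 1)) = v then 2 else 0)) +
      (∑ i ∈ Finset.range (n - 1), ∑ k ∈ Finset.range (n - 1 - i),
        if DnLabel.V (i + 2 + k) (k + 1) = u ∧ DnLabel.V (i + 1 + k) k = v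
          then 2 else 0)) := by
  simp only [dnArrows, bind_pure_list_range, List.map_map, Function.comp_def,
    arrowWeight_append, arrowWeight_flatMap_range, arrowWeight_map_range, arrowWeight_pair,
    Finset.sum_add_distrib]

lemma arrowWeight_V_V (n : ℕ) (a b a' b' : ℤ) :
    arrowWeight (dnArrows n) (.V a b) (.V a' b') =
      (if 1 ≤ a ∧ a ≤ n ∧ -a ≤ b ∧ b < a ∧ a' = a ∧ b' = b + 1 then 2 else 0) +
      (if b' = b ∧ (b < 0 ∧ a' = a - 1 ∧ -b < a ∧ a ≤ n ∧ -b ≤ n ∨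
        0 < b ∧ a' = a + 1 ∧ b ≤ a ∧ a < n) then 2 else 0) +
      (if 1 ≤ a ∧ a < n ∧ b = -a ∧ a' = a + 1 ∧ b' = b - 1 then 1 else 0) +
      (if 1 < a ∧ a ≤ n ∧ b = a ∧ a' = a - 1 ∧ b' = b - 1 then 1 else 0) +
      (if b ≤ 0 ∧ 1 ≤ a + b ∧ a < n ∧ a' = a + 1 ∧ b' = b - 1 then 2 else 0) +
      (if 1 ≤ b ∧ 1 ≤ a - b ∧ a ≤ n ∧ a' = a - 1 ∧ b' = b - 1 then 2 else 0) := by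
  rw [arrowWeight_dnArrows]
  simp only [Lam_eq_V_iff, DnLabel.V.injEq, reduceCtorEq, false_and, and_false, if_false,
    Finset.sum_const_zero, add_zero, ← add_assoc]
  congr 1; congr 1; congr 1; congr 1; congr 1
  · refine sum_range_sum_range_ite_eq_ite (a - 1).toNat (a + b).toNat ?_ ?_ <;> omega
  · rcases le_or_gt b 0 with hb | hb
    · refine sum_range_sum_range_ite_eq_ite (n + b).toNat (2 * n + 2 - a + b).toNat ?_ ?_ <;> omega
    · refine sum_range_sum_range_ite_eq_ite (n - b).toNat (a - b).toNat ?_ ?_ <;> omega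
  · refine sum_range_ite_eq_ite (a - 1).toNat ?_ ?_ <;> omega
  · refine sum_range_ite_eq_ite (a - 2).toNat ?_ ?_ <;> omega
  · refine sum_range_sum_range_ite_eq_ite (a - 1 + b).toNat (-b).toNat ?_ ?_ <;> omega
  · refine sum_range_sum_range_ite_eq_ite (a - 1 - b).toNat (b - 1).toNat ?_ ?_ <;> omega

lemma arrowWeight_V_C (n : ℕ) (a b c : ℤ) :
    arrowWeight (dnArrows n) (.V a b) (.C c) =
      (if 1 ≤ c ∧ c ≤ n ∧ a = n ∧ b = n + 1 - c then 2 else 0) +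
      (if 1 ≤ c ∧ c < n ∧ a = n ∧ b = c - n then 2 else 0) := by
  rw [arrowWeight_dnArrows]
  simp only [Lam_eq_V_iff, Lam_eq_C_iff, DnLabel.V.injEq, DnLabel.C.injEq, reduceCtorEq,
    and_false, if_false, Finset.sum_const_zero, zero_add, add_zero]
  congr 1
  · refine sum_range_sum_range_ite_eq_ite (c - 1).toNat (c - 1).toNat ?_ ?_ <;> omega
  · refine sum_range_ite_eq_ite (c - 1).toNat ?_ ?_ <;> omega

lemma arrowWeight_C_V (n : ℕ) (a b c : ℤ) :
    arrowWeight (dnArrows n) (.C c) (.V a b) =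
      (if 1 ≤ c ∧ c ≤ n ∧ a = n ∧ b = c - n - 1 then 2 else 0) +
      (if 1 ≤ c ∧ c < n ∧ a = n ∧ b = n - c then 2 else 0) := by
  rw [arrowWeight_dnArrows]
  simp only [Lam_eq_V_iff, Lam_eq_C_iff, DnLabel.V.injEq, DnLabel.C.injEq, reduceCtorEq, false_and,
    and_false, if_false, Finset.sum_const_zero, zero_add, add_zero]
  congr 1
  · refine sum_range_sum_range_ite_eq_ite (c - 1).toNat c.toNat ?_ ?_ <;> omega
  · refine sum_range_ite_eq_ite (c - 1).toNat ?_ ?_ <;> omega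

lemma arrowWeight_C_C (n : ℕ) (c c' : ℤ) : arrowWeight (dnArrows n) (.C c) (.C c') = 0 := by
  rw [arrowWeight_dnArrows]
  simp only [Lam_eq_C_iff, reduceCtorEq, false_and, and_false, if_false, Finset.sum_const_zero,
    zero_add, add_zero]
  refine Finset.sum_eq_zero fun i _ => Finset.sum_eq_zero fun k _ => if_neg ?_
  omega

/-- The pairing of the rows `L i` and `L j`, `i ≤ j`, under the doubled exchange matrix. -/
structure IsRowPairing (n : ℕ) (L : ℤ → ℤ → DnLabel) : Prop where
  valid : ∀ i r, 1 ≤ i → i ≤ (n : ℤ) → -i ≤ r → r ≤ i → (L i r).valid n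
  same : ∀ i k l, 1 ≤ i → i ≤ (n : ℤ) → -i ≤ k → k < i → -i ≤ l → l < i →
    eps2 n (L i l) (L i k) = if k = l + 1 then 2 else if l = k + 1 then -2 else 0
  adj : ∀ i k l, 1 ≤ i → i < (n : ℤ) → -i ≤ k → k < i → -(i + 1) ≤ l → l < i + 1 →
    eps2 n (L (i + 1) l) (L i k) =
      if l = k then (if k = 0 then 0 else if k < 0 then 2 else -2)
      else if l = k + 1 then (if 0 ≤ k then 2 else 0)
      else if l = k - 1 then (if k = -i then -1 else if k ≤ 0 then -2 else 0) else 0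
  far : ∀ i j k l, 1 ≤ i → i + 1 < j → j ≤ (n : ℤ) → -i ≤ k → k < i → -j ≤ l → l < j →
    eps2 n (L j l) (L i k) = 0

lemma isRowPairing_V (n : ℕ) : IsRowPairing n .V where
  valid i r h₁ h₂ h₃ h₄ := ⟨h₁, h₂, h₃, h₄⟩
  same i k l h₁ h₂ h₃ h₄ h₅ h₆ := by
    rw [eps2_eq_arrowWeight_sub, arrowWeight_V_V, arrowWeight_V_V]
    obtain h | h | h : k = l + 1 ∨ l = k + 1 ∨ ¬ k = l + 1 ∧ ¬ l = k + 1 := by omega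
    all_goals simp (disch := omega) only [if_pos, if_neg] <;> norm_num <;> omega
  adj i k l h₁ h₂ h₃ h₄ h₅ h₆ := by
    rw [eps2_eq_arrowWeight_sub, arrowWeight_V_V, arrowWeight_V_V]
    obtain h | h | h | h : l = k ∨ l = k + 1 ∨ l = k - 1 ∨ ¬ l = k ∧ ¬ l = k + 1 ∧ ¬ l = k - 1 := by
      omega
    all_goals
      obtain h' | h' | h' | h' : k = -i ∨ -i < k ∧ k < 0 ∨ k = 0 ∨ 0 < k := by omega
    all_goals simp (disch := omega) only [if_pos, if_neg] <;> norm_num <;> omega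
  far i j k l h₁ h₂ h₃ h₄ h₅ h₆ h₇ := by
    rw [eps2_eq_arrowWeight_sub, arrowWeight_V_V, arrowWeight_V_V]
    simp (disch := omega) only [if_neg]
    norm_num

lemma isRowPairing_Lam (n : ℕ) : IsRowPairing n (Lam n) where
  valid i r h₁ h₂ h₃ h₄ := by
    unfold Lam th
    split_ifs <;> simp only [DnLabel.valid] <;> omega
  same i k l h₁ h₂ h₃ h₄ h₅ h₆ := by
    rw [eps2_eq_arrowWeight_sub]
    obtain h | h | h : k = l + 1 ∨ l = k + 1 ∨ ¬ k = l + 1 ∧ ¬ l = k + 1 := by omega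
    all_goals
      unfold Lam th
      rcases lt_trichotomy k 0 with hk | hk | hk <;> rcases lt_trichotomy l 0 with hl | hl | hl
    all_goals try omega
    all_goals simp (disch := omega) only [if_pos, if_neg, arrowWeight_V_V, arrowWeight_V_C,
      arrowWeight_C_V, arrowWeight_C_C] <;> norm_num <;> omega
  adj i k l h₁ h₂ h₃ h₄ h₅ h₆ := by
    rw [eps2_eq_arrowWeight_sub]
    obtain h | h | h | h : l = k ∨ l = k + 1 ∨ l = k - 1 ∨ ¬ l = k ∧ ¬ l = k + 1 ∧ ¬ l = k - 1 := by
      omega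
    all_goals
      obtain h' | h' | h' | h' : k = -i ∨ -i < k ∧ k < 0 ∨ k = 0 ∨ 0 < k := by omega
    all_goals
      unfold Lam th
      rcases lt_trichotomy l 0 with hl | hl | hl
    all_goals try omega
    all_goals simp (disch := omega) only [if_pos, if_neg, arrowWeight_V_V, arrowWeight_V_C,
      arrowWeight_C_V, arrowWeight_C_C] <;> norm_num
  far i j k l h₁ h₂ h₃ h₄ h₅ h₆ h₇ := by
    rw [eps2_eq_arrowWeight_sub]
    unfold Lam th
    rcases lt_trichotomy k 0 with hk | hk | hk <;> rcases lt_trichotomy l 0 with hl | hl | hl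
    all_goals simp (disch := omega) only [if_pos, if_neg, arrowWeight_V_V, arrowWeight_V_C,
      arrowWeight_C_V, arrowWeight_C_C] <;> norm_num

section Ladder

variable {K A : Type*} [Field K] [Ring A] [Algebra K A]

/-- Rows `0, …, N` of elements `v k r` (`r ∈ S k`) of an algebra, which `q`-commute within a row
and between adjacent rows, and commute between non-adjacent rows.  The relation `P` singles out
the pairs from adjacent rows that commute up to `q` rather than `q⁻¹`. -/
structure IsLadder (N : ℕ) (q : K) (S : ℕ → Finset ℤ) (P : ℤ → ℤ → Prop) (v : ℕ → ℤ → A) :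
    Prop where
  ne_zero : q ≠ 0
  same : ∀ k ≤ N, ∀ a ∈ S k, ∀ b ∈ S k, a < b →
    v k a * v k b = q ^ (-2 : ℤ) • (v k b * v k a)
  pos : ∀ k < N, ∀ r ∈ S k, ∀ s ∈ S (k + 1), P r s →
    v (k + 1) s * v k r = q • (v k r * v (k + 1) s)
  neg : ∀ k < N, ∀ r ∈ S k, ∀ s ∈ S (k + 1), ¬ P r s →
    v (k + 1) s * v k r = q⁻¹ • (v k r * v (k + 1) s)
  far : ∀ k l, k + 1 < l → l ≤ N → ∀ r ∈ S k, ∀ s ∈ S l, Commute (v l s) (v k r)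
  mono : ∀ r r' s, r < r' → P r s → P r' s

open Classical in
/-- The sum of the products `v 0 r₀ * ⋯ * v k rₖ` over the `P`-chains `r₀, …, rₖ` ending at `s`. -/
def pathEnd (S : ℕ → Finset ℤ) (P : ℤ → ℤ → Prop) (v : ℕ → ℤ → A) : ℕ → ℤ → A
  | 0, s => v 0 s
  | k + 1, s => (∑ r ∈ S k with P r s, pathEnd S P v k r) * v (k + 1) s

open Classical in
/-- The sum of the products over the `P`-chains that can be prolonged to `s` in the next row. -/
def pathTo (S : ℕ → Finset ℤ) (P : ℤ → ℤ → Prop) (v : ℕ → ℤ → A) (k : ℕ) (s : ℤ) : A :=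
  ∑ r ∈ S k with P r s, pathEnd S P v k r

open Classical in
/-- The sum of the products over the `P`-chains that cannot be prolonged to `s` in the next row. -/
def pathOff (S : ℕ → Finset ℤ) (P : ℤ → ℤ → Prop) (v : ℕ → ℤ → A) (k : ℕ) (s : ℤ) : A :=
  ∑ r ∈ S k with ¬ P r s, pathEnd S P v k r

lemma pathEnd_succ (S : ℕ → Finset ℤ) (P : ℤ → ℤ → Prop) (v : ℕ → ℤ → A) (k : ℕ) (s : ℤ) :
    pathEnd S P v (k + 1) s = pathTo S P v k s * v (k + 1) s := rfl

lemma pathTo_add_pathOff (S : ℕ → Finset ℤ) (P : ℤ → ℤ → Prop) (v : ℕ → ℤ → A) (k : ℕ) (s : ℤ) :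
    pathTo S P v k s + pathOff S P v k s = ∑ r ∈ S k, pathEnd S P v k r :=
  by classical exact Finset.sum_filter_add_sum_filter_not _ _ _

lemma commute_pathEnd {S : ℕ → Finset ℤ} {P : ℤ → ℤ → Prop} {v : ℕ → ℤ → A} {x : A} {k : ℕ}
    (h : ∀ l ≤ k, ∀ r ∈ S l, Commute x (v l r)) {s : ℤ} (hs : s ∈ S k) :
    Commute x (pathEnd S P v k s) := by
  induction k generalizing s with
  | zero => exact h 0 le_rfl s hs
  | succ k ih =>
    classical
    refine Commute.mul_right (Commute.sum_right _ _ _ fun r hr => ?_) (h _ le_rfl s hs)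
    exact ih (fun l hl => h l (by omega)) (Finset.mem_filter.1 hr).1

lemma commute_pathTo {S : ℕ → Finset ℤ} {P : ℤ → ℤ → Prop} {v : ℕ → ℤ → A} {x : A} {k : ℕ}
    (h : ∀ l ≤ k, ∀ r ∈ S l, Commute x (v l r)) (s : ℤ) : Commute x (pathTo S P v k s) := by
  classical
  exact Commute.sum_right _ _ _ fun _ hr => commute_pathEnd h (Finset.mem_filter.1 hr).1

lemma mul_sum_eq_smul {ι : Type*} {T : Finset ι} {f : ι → A} {x : A} {c : K}
    (h : ∀ i ∈ T, x * f i = c • (f i * x)) : x * ∑ i ∈ T, f i = c • ((∑ i ∈ T, f i) * x) := by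
  rw [Finset.mul_sum, Finset.sum_mul, Finset.smul_sum]
  exact Finset.sum_congr rfl h

lemma sum_mul_sum_eq_smul {ι : Type*} {T T' : Finset ι} {f : ι → A} {c : K}
    (h : ∀ i ∈ T, ∀ j ∈ T', f i * f j = c • (f j * f i)) :
    (∑ i ∈ T, f i) * ∑ j ∈ T', f j = c • ((∑ j ∈ T', f j) * ∑ i ∈ T, f i) := by
  rw [Finset.sum_mul, Finset.mul_sum, Finset.smul_sum]
  exact Finset.sum_congr rfl fun i hi => mul_sum_eq_smul (h i hi)

namespace IsLadder

variable {N : ℕ} {q : K} {S : ℕ → Finset ℤ} {P : ℤ → ℤ → Prop} {v : ℕ → ℤ → A}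

lemma mul_pathEnd (h : IsLadder N q S P v) {k : ℕ} (hk : k < N) {r s : ℤ} (hr : r ∈ S k)
    (hs : s ∈ S (k + 1)) {c : K}
    (hc : v (k + 1) s * v k r = c • (v k r * v (k + 1) s)) :
    v (k + 1) s * pathEnd S P v k r = c • (pathEnd S P v k r * v (k + 1) s) := by
  cases k with
  | zero => exact hc
  | succ k =>
    have hU : Commute (v (k + 1 + 1) s) (pathTo S P v k r) :=
      commute_pathTo (fun l hl r hr => h.far l (k + 1 + 1) (by omega) (by omega) r hr s hs) r
    rw [pathEnd_succ, ← mul_assoc, hU.eq, mul_assoc, hc, mul_smul_comm, mul_assoc]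

lemma mul_pathTo (h : IsLadder N q S P v) {k : ℕ} (hk : k < N) {s : ℤ} (hs : s ∈ S (k + 1)) :
    v (k + 1) s * pathTo S P v k s = q • (pathTo S P v k s * v (k + 1) s) := by
  classical
  refine mul_sum_eq_smul fun r hr => ?_
  rw [Finset.mem_filter] at hr
  exact h.mul_pathEnd hk hr.1 hs (h.pos k hk r hr.1 s hs hr.2)

lemma mul_pathOff (h : IsLadder N q S P v) {k : ℕ} (hk : k < N) {s : ℤ} (hs : s ∈ S (k + 1)) :
    v (k + 1) s * pathOff S P v k s = q⁻¹ • (pathOff S P v k s * v (k + 1) s) := by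
  classical
  refine mul_sum_eq_smul fun r hr => ?_
  rw [Finset.mem_filter] at hr
  exact h.mul_pathEnd hk hr.1 hs (h.neg k hk r hr.1 s hs hr.2)

/-- If every chain prolonging to `a` also prolongs to `b`, the remaining chains to `b`
have `q`-commutation relations with those to `a` and with `v (k + 1) a`. -/
lemma exists_pathTo_eq_add (h : IsLadder N q S P v) {k : ℕ} (hk : k < N)
    (hZ : ∀ r ∈ S k, ∀ r' ∈ S k, r < r' → pathEnd S P v k r * pathEnd S P v k r' =
      q ^ (-2 : ℤ) • (pathEnd S P v k r' * pathEnd S P v k r))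
    {a b : ℤ} (ha : a ∈ S (k + 1)) (hb : b ∈ S (k + 1)) (hab : ∀ r ∈ S k, P r a → P r b) :
    ∃ R, pathTo S P v k b = pathTo S P v k a + R ∧
      v (k + 1) a * R = q⁻¹ • (R * v (k + 1) a) ∧
      v (k + 1) b * pathTo S P v k a = q • (pathTo S P v k a * v (k + 1) b) ∧
      R * pathTo S P v k a = q ^ (-2 : ℤ) • (pathTo S P v k a * R) := by
  classical
  refine ⟨∑ r ∈ S k with P r b ∧ ¬ P r a, pathEnd S P v k r, ?_, ?_, ?_, ?_⟩
  · unfold pathTo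
    rw [← Finset.sum_filter_add_sum_filter_not (Finset.filter (P · b) (S k)) (P · a),
      Finset.filter_filter, Finset.filter_filter]
    congr 1
    refine Finset.sum_congr ?_ fun _ _ => rfl
    ext r
    simp only [Finset.mem_filter]
    exact ⟨fun hr => ⟨hr.1, hr.2.2⟩, fun hr => ⟨hr.1, hab r hr.1 hr.2, hr.2⟩⟩
  · refine mul_sum_eq_smul fun r hr => ?_
    rw [Finset.mem_filter] at hr
    exact h.mul_pathEnd hk hr.1 ha (h.neg k hk r hr.1 a ha hr.2.2)
  · refine mul_sum_eq_smul fun r hr => ?_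
    rw [Finset.mem_filter] at hr
    exact h.mul_pathEnd hk hr.1 hb (h.pos k hk r hr.1 b hb (hab r hr.1 hr.2))
  · refine sum_mul_sum_eq_smul fun r hr r' hr' => ?_
    rw [Finset.mem_filter] at hr hr'
    refine hZ r hr.1 r' hr'.1 (lt_of_not_ge fun hle => hr.2.2 ?_)
    rcases hle.eq_or_lt with rfl | hlt
    · exact hr'.2
    · exact h.mono _ _ _ hlt hr'.2

lemma subset_total (h : IsLadder N q S P v) (k : ℕ) (a b : ℤ) :
    (∀ r ∈ S k, P r a → P r b) ∨ ∀ r ∈ S k, P r b → P r a := by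
  by_contra! hcon
  obtain ⟨⟨r, -, hra, hrb⟩, r', -, hrb', hra'⟩ := hcon
  rcases lt_trichotomy r r' with hlt | rfl | hlt
  · exact hra' (h.mono _ _ _ hlt hra)
  · exact hra' hra
  · exact hrb (h.mono _ _ _ hlt hrb')

lemma exists_mul_pathTo (h : IsLadder N q S P v) {k : ℕ} (hk : k < N)
    (hZ : ∀ r ∈ S k, ∀ r' ∈ S k, r < r' → pathEnd S P v k r * pathEnd S P v k r' =
      q ^ (-2 : ℤ) • (pathEnd S P v k r' * pathEnd S P v k r))
    {a b : ℤ} (ha : a ∈ S (k + 1)) (hb : b ∈ S (k + 1)) :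
    ∃ Y Y', v (k + 1) a * pathTo S P v k b = Y * v (k + 1) a ∧
      v (k + 1) b * pathTo S P v k a = Y' * v (k + 1) b ∧
      pathTo S P v k a * Y = pathTo S P v k b * Y' := by
  wlog hab : ∀ r ∈ S k, P r a → P r b generalizing a b
  · obtain ⟨Y, Y', h₁, h₂, h₃⟩ := this hb ha ((h.subset_total k a b).resolve_left hab)
    exact ⟨Y', Y, h₂, h₁, h₃.symm⟩
  obtain ⟨R, hR, haR, hbU, hRU⟩ := h.exists_pathTo_eq_add hk hZ ha hb hab
  have haU := h.mul_pathTo hk ha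
  have hq := h.ne_zero
  set U := pathTo S P v k a
  refine ⟨q • U + q⁻¹ • R, q • U, ?_, ?_, ?_⟩
  · rw [hR, mul_add, haU, haR, add_mul, smul_mul_assoc, smul_mul_assoc]
  · rw [hbU, smul_mul_assoc]
  · rw [hR, mul_add, add_mul, mul_smul_comm, mul_smul_comm, mul_smul_comm, hRU]
    match_scalars <;> field_simp

lemma exists_pathTo_mul (h : IsLadder N q S P v) {k : ℕ} (hk : k < N)
    (hZ : ∀ r ∈ S k, ∀ r' ∈ S k, r < r' → pathEnd S P v k r * pathEnd S P v k r' =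
      q ^ (-2 : ℤ) • (pathEnd S P v k r' * pathEnd S P v k r))
    {a b : ℤ} (ha : a ∈ S (k + 1)) (hb : b ∈ S (k + 1)) :
    ∃ Y Y', pathTo S P v k a * v (k + 1) b = v (k + 1) b * Y ∧
      pathTo S P v k b * v (k + 1) a = v (k + 1) a * Y' ∧
      Y * pathTo S P v k b = Y' * pathTo S P v k a := by
  wlog hab : ∀ r ∈ S k, P r a → P r b generalizing a b
  · obtain ⟨Y, Y', h₁, h₂, h₃⟩ := this hb ha ((h.subset_total k a b).resolve_left hab)
    exact ⟨Y', Y, h₂, h₁, h₃.symm⟩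
  obtain ⟨R, hR, haR, hbU, hRU⟩ := h.exists_pathTo_eq_add hk hZ ha hb hab
  have haU := h.mul_pathTo hk ha
  have hq := h.ne_zero
  set U := pathTo S P v k a
  refine ⟨q⁻¹ • U, q⁻¹ • U + q • R, ?_, ?_, ?_⟩
  · rw [mul_smul_comm, hbU, inv_smul_smul₀ hq]
  · rw [hR, mul_add, mul_smul_comm, mul_smul_comm, haU, haR, add_mul, inv_smul_smul₀ hq,
      smul_inv_smul₀ hq]
  · rw [hR, mul_add, add_mul, smul_mul_assoc, smul_mul_assoc, smul_mul_assoc, hRU]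
    match_scalars <;> field_simp

/-- Chain sums with different endpoints in the same row `q`-commute. -/
theorem pathEnd_mul_pathEnd (h : IsLadder N q S P v) {k : ℕ} (hk : k ≤ N) {a b : ℤ}
    (ha : a ∈ S k) (hb : b ∈ S k) (hab : a < b) :
    pathEnd S P v k a * pathEnd S P v k b =
      q ^ (-2 : ℤ) • (pathEnd S P v k b * pathEnd S P v k a) := by
  induction k generalizing a b with
  | zero => exact h.same 0 hk a ha b hb hab
  | succ k ih =>
    obtain ⟨Y, Y', hY, hY', hYY⟩ := h.exists_mul_pathTo hk
      (fun r hr r' hr' hlt => ih (by omega) hr hr' hlt) ha hb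
    have hw := h.same _ hk a ha b hb hab
    rw [pathEnd_succ, pathEnd_succ]
    set U := pathTo S P v k a
    set U' := pathTo S P v k b
    calc U * v (k + 1) a * (U' * v (k + 1) b)
        = U * (v (k + 1) a * U') * v (k + 1) b := by simp only [mul_assoc]
      _ = U * Y * (v (k + 1) a * v (k + 1) b) := by rw [hY]; simp only [mul_assoc]
      _ = q ^ (-2 : ℤ) • (U' * (Y' * v (k + 1) b) * v (k + 1) a) := by
        rw [hw, hYY, mul_smul_comm]; simp only [mul_assoc]
      _ = q ^ (-2 : ℤ) • (U' * v (k + 1) b * (U * v (k + 1) a)) := by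
        rw [← hY']; simp only [mul_assoc]

/-- Iterated `q`-commutators of the row sums are, up to a scalar, sums over all chains. -/
lemma eq_smul_sum_pathEnd (h : IsLadder N q S P v) {β : K} {G : ℕ → A}
    (h0 : G 0 = ∑ s ∈ S 0, v 0 s)
    (hG : ∀ k < N, G (k + 1) = β • ((∑ s ∈ S (k + 1), v (k + 1) s) * G k -
      q⁻¹ • (G k * ∑ s ∈ S (k + 1), v (k + 1) s))) {k : ℕ} (hk : k ≤ N) :
    G k = (β * (q - q⁻¹)) ^ k • ∑ s ∈ S k, pathEnd S P v k s := by
  induction k with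
  | zero => rw [h0, pow_zero, one_smul]; rfl
  | succ k ih =>
    rw [hG k hk, ih (by omega)]
    generalize hZ : ∑ s ∈ S k, pathEnd S P v k s = Z
    rw [Finset.sum_mul, Finset.mul_sum, Finset.smul_sum, ← Finset.sum_sub_distrib,
      Finset.smul_sum, Finset.smul_sum]
    refine Finset.sum_congr rfl fun s hs => ?_
    rw [pathEnd_succ, ← hZ, ← pathTo_add_pathOff S P v k s, mul_smul_comm, mul_add,
      h.mul_pathTo hk hs, h.mul_pathOff hk hs, smul_mul_assoc, add_mul]
    module

end IsLadder

end Ladder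

/-! ### Row monomials in the quantum torus -/

lemma qq_ne_zero : qq ≠ 0 := RatFunc.X_ne_zero

lemma qq_sub_inv_ne_zero : qq - qq⁻¹ ≠ 0 := by
  intro h
  have h2 : qq ^ 2 = 1 := by
    have := qq_ne_zero
    field_simp at h
    linear_combination h
  have hX : algebraMap (Polynomial ℂ) (RatFunc ℂ) (Polynomial.X ^ 2) =
      algebraMap (Polynomial ℂ) (RatFunc ℂ) 1 := by
    rw [map_pow, map_one, RatFunc.algebraMap_X]
    exact h2
  have := congrArg Polynomial.natDegree (RatFunc.algebraMap_injective ℂ hX)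
  simp at this

lemma Xg_mul_Xg (n : ℕ) {u v : DnLabel} (hu : u.valid n) (hv : v.valid n) :
    Xg n u * Xg n v = qq ^ eps2 n v u • (Xg n v * Xg n u) := by
  have h := RingQuot.mkAlgHom_rel Kq (DnRel.comm (n := n) ⟨u, hu⟩ ⟨v, hv⟩)
  rw [map_mul, map_smul, map_mul] at h
  simpa only [Xg, dif_pos hu, dif_pos hv] using h

/-- Ordered products of `q`-commuting elements `q`-commute, with an exponent `c` that is a discrete
double antiderivative of the exponents `e` of the factors. -/
lemma prod_range_mul_prod_range {K A : Type*} [Field K] [Ring A] [Algebra K A] {q : K}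
    (hq : q ≠ 0) {x y : ℕ → A} {e c : ℕ → ℕ → ℤ} {M N : ℕ}
    (hxy : ∀ k < M, ∀ l < N, x k * y l = q ^ e k l • (y l * x k))
    (hc₁ : ∀ l, c 0 l = 0) (hc₂ : ∀ k, c k 0 = 0)
    (hc : ∀ k < M, ∀ l < N, c (k + 1) (l + 1) = c k (l + 1) + c (k + 1) l - c k l + e k l)
    {k l : ℕ} (hk : k ≤ M) (hl : l ≤ N) :
    ((List.range k).map x).prod * ((List.range l).map y).prod =
      q ^ c k l • (((List.range l).map y).prod * ((List.range k).map x).prod) := by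
  have hx : ∀ k < M, ∀ l ≤ N, x k * ((List.range l).map y).prod =
      q ^ (c (k + 1) l - c k l) • (((List.range l).map y).prod * x k) := by
    intro k hk l hl
    induction l with
    | zero => simp [hc₂]
    | succ l ih =>
      rw [List.prod_range_succ, ← mul_assoc, ih (by omega), smul_mul_assoc, mul_assoc,
        hxy k hk l hl, mul_smul_comm, smul_smul, ← zpow_add₀ hq, mul_assoc, hc k hk l hl]
      congr 2
      ring
  induction k with
  | zero => simp [hc₁]
  | succ k ih =>
    rw [List.prod_range_succ, mul_assoc, hx k hk l hl, mul_smul_comm, ← mul_assoc, ih (by omega),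
      smul_mul_assoc, smul_smul, ← zpow_add₀ hq, mul_assoc]
    congr 2
    ring

/-- The monomial `𝐢 q^{i+r} X_{L i (-i)} ⋯ X_{L i r}` attached to a path of labels. -/
def rowMonomial (n : ℕ) (L : ℤ → ℤ → DnLabel) (i r : ℤ) : Dtorus n :=
  (ii * qq ^ (i + r)) • ((List.range (r + i + 1).toNat).map fun k : ℕ => Xg n (L i (-i + k))).prod

lemma ww_eq_rowMonomial (n : ℕ) : ww n = rowMonomial n .V := by
  funext i r
  simp only [ww, Vprod, rowMonomial, bind_pure_list_range, List.map_map, Function.comp_def]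

lemma mm_eq_rowMonomial (n : ℕ) : mm n = rowMonomial n (Lam n) := by
  funext i r
  simp only [mm, Lprod, rowMonomial, bind_pure_list_range, List.map_map, Function.comp_def]

/-- The relation between `r` and `s` under which `w_i^r w_{i+1}^s = q⁻¹ w_{i+1}^s w_i^r`. -/
def rowLT (r s : ℤ) : Prop := s < r ∨ s = r ∧ 0 ≤ r

instance (r s : ℤ) : Decidable (rowLT r s) := by unfold rowLT; infer_instance

/-- The `q`-commutation relations satisfied by the elements `w_i^r`, and by the `m_i^r`. -/
structure IsRowFamily (n : ℕ) (w : ℤ → ℤ → Dtorus n) : Prop where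
  same : ∀ i a b : ℤ, 1 ≤ i → i ≤ n → -i ≤ a → a < b → b ≤ i - 1 →
    w i a * w i b = qq ^ (-2 : ℤ) • (w i b * w i a)
  adj : ∀ i r s : ℤ, 1 ≤ i → i < n → -i ≤ r → r ≤ i - 1 → -(i + 1) ≤ s → s ≤ i →
    w i r * w (i + 1) s = qq ^ (if rowLT r s then -1 else 1 : ℤ) • (w (i + 1) s * w i r)
  far : ∀ i j r s : ℤ, 1 ≤ i → i + 1 < j → j ≤ n → -i ≤ r → r ≤ i - 1 → -j ≤ s → s ≤ j - 1 →
    Commute (w i r) (w j s)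

namespace IsRowPairing

variable {n : ℕ} {L : ℤ → ℤ → DnLabel}

lemma rowMonomial_mul (h : IsRowPairing n L) {i j r s : ℤ} {c : ℕ → ℕ → ℤ} (hi : 1 ≤ i)
    (hi' : i ≤ n) (hj : 1 ≤ j) (hj' : j ≤ n) (hr' : r ≤ i - 1) (hs' : s ≤ j - 1)
    (hc₁ : ∀ l, c 0 l = 0) (hc₂ : ∀ k, c k 0 = 0)
    (hc : ∀ k l : ℕ, k < 2 * i → l < 2 * j → c (k + 1) (l + 1) =
      c k (l + 1) + c (k + 1) l - c k l + eps2 n (L j (-j + l)) (L i (-i + k))) :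
    rowMonomial n L i r * rowMonomial n L j s =
      qq ^ c (r + i + 1).toNat (s + j + 1).toNat • (rowMonomial n L j s * rowMonomial n L i r) := by
  have key := prod_range_mul_prod_range qq_ne_zero (M := (2 * i).toNat) (N := (2 * j).toNat)
    (x := fun k : ℕ => Xg n (L i (-i + k))) (y := fun l : ℕ => Xg n (L j (-j + l)))
    (e := fun k l => eps2 n (L j (-j + l)) (L i (-i + k))) (c := c)
    (fun k hk l hl => Xg_mul_Xg n (h.valid _ _ hi hi' (by omega) (by omega))
      (h.valid _ _ hj hj' (by omega) (by omega))) hc₁ hc₂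
    (fun k hk l hl => hc k l (by omega) (by omega))
    (show (r + i + 1).toNat ≤ _ by omega) (show (s + j + 1).toNat ≤ _ by omega)
  rw [rowMonomial, rowMonomial, smul_mul_smul_comm, key, smul_mul_smul_comm, smul_comm,
    mul_comm (ii * _)]

lemma isRowFamily (h : IsRowPairing n L) : IsRowFamily n (rowMonomial n L) where
  same i a b h₁ h₂ h₃ h₄ h₅ := by
    rw [h.rowMonomial_mul (c := fun k l : ℕ =>
      if k = 0 ∨ l = 0 then 0 else if k < l then -2 else if k = l then 0 else 2)
      h₁ h₂ h₁ h₂ (by omega) (by omega) (by simp) (by simp)]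
    · congr 2
      omega
    · intro k l hk hl
      rw [h.same i _ _ h₁ h₂ (by omega) (by omega) (by omega) (by omega)]
      omega
  adj i r s h₁ h₂ h₃ h₄ h₅ h₆ := by
    rw [h.rowMonomial_mul (c := fun k l : ℕ => if k = 0 ∨ l = 0 then 0 else
      if l ≤ k ∨ l = k + 1 ∧ i + 1 ≤ k then -1 else 1)
      h₁ (by omega) (by omega) (by omega) (by omega) (by omega) (by simp) (by simp)]
    · congr 2
      simp only [rowLT]
      omega
    · intro k l hk hl
      rw [h.adj i _ _ h₁ h₂ (by omega) (by omega) (by omega) (by omega)]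
      obtain h | h | h | h :
          l = k + 1 ∨ l = k + 2 ∨ l = k ∨ ¬ l = k + 1 ∧ ¬ l = k + 2 ∧ ¬ l = k := by
        omega
      all_goals grind
  far i j r s h₁ h₂ h₃ h₄ h₅ h₆ h₇ := by
    have := h.rowMonomial_mul (i := i) (j := j) (r := r) (s := s) (c := fun _ _ => 0) h₁
      (by omega) (by omega) h₃ h₅ h₇ (by simp) (by simp) fun k l hk hl => by
        rw [h.far i j _ _ h₁ h₂ h₃ (by omega) (by omega) (by omega) (by omega)]
        rfl
    rwa [zpow_zero, one_smul] at this

end IsRowPairing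

/-! ### Ladders of row monomials -/

lemma not_rowLT_of_lt {r r' s : ℤ} (hr : r < r') (h : ¬ rowLT s r) : ¬ rowLT s r' := by
  unfold rowLT at *
  omega

lemma rowLT_of_lt {r r' s : ℤ} (hr : r < r') (h : rowLT r s) : rowLT r' s := by
  unfold rowLT at *
  omega

lemma rowLT_neg_of_lt {r r' s : ℤ} (hr : r < r') (h : rowLT (-s) (-r)) : rowLT (-s) (-r') := by
  unfold rowLT at *
  omega

namespace IsRowFamily

variable {n : ℕ} {w : ℤ → ℤ → Dtorus n}

lemma adj_pos (h : IsRowFamily n w) {i r s : ℤ} (hi : 1 ≤ i) (hi' : i < n) (hr : -i ≤ r)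
    (hr' : r ≤ i - 1) (hs : -(i + 1) ≤ s) (hs' : s ≤ i) (hrs : rowLT r s) :
    w i r * w (i + 1) s = qq⁻¹ • (w (i + 1) s * w i r) := by
  rw [h.adj i r s hi hi' hr hr' hs hs', if_pos hrs, zpow_neg_one]

lemma adj_neg (h : IsRowFamily n w) {i r s : ℤ} (hi : 1 ≤ i) (hi' : i < n) (hr : -i ≤ r)
    (hr' : r ≤ i - 1) (hs : -(i + 1) ≤ s) (hs' : s ≤ i) (hrs : ¬ rowLT r s) :
    w i r * w (i + 1) s = qq • (w (i + 1) s * w i r) := by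
  rw [h.adj i r s hi hi' hr hr' hs hs', if_neg hrs, zpow_one]

lemma isLadder_ascending (h : IsRowFamily n w) {i : ℤ} (hi : 1 ≤ i) (hi' : i ≤ n) :
    IsLadder (n - i).toNat qq (fun k => Finset.Icc (-(i + k)) (i + k - 1)) rowLT
      (fun k => w (i + k)) where
  ne_zero := qq_ne_zero
  same k hk a ha b hb hab := by
    rw [Finset.mem_Icc] at ha hb
    exact h.same _ _ _ (by omega) (by omega) ha.1 hab hb.2
  pos k hk r hr s hs hrs := by
    rw [Finset.mem_Icc] at hr hs
    push_cast at hs ⊢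
    rw [← add_assoc, h.adj_pos (by omega) (by omega) hr.1 hr.2 (by omega) (by omega) hrs,
      smul_inv_smul₀ qq_ne_zero]
  neg k hk r hr s hs hrs := by
    rw [Finset.mem_Icc] at hr hs
    push_cast at hs ⊢
    rw [← add_assoc, h.adj_neg (by omega) (by omega) hr.1 hr.2 (by omega) (by omega) hrs,
      inv_smul_smul₀ qq_ne_zero]
  far k l hkl hl r hr s hs := by
    rw [Finset.mem_Icc] at hr hs
    exact (h.far _ _ _ _ (by omega) (by omega) (by omega) hr.1 hr.2 hs.1 hs.2).symm
  mono _ _ _ := rowLT_of_lt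

lemma isLadder_descending (h : IsRowFamily n w) {t : ℤ} (ht : t ≤ n) :
    IsLadder (t - 1).toNat qq (fun k => Finset.Icc (-(t - k)) (t - k - 1))
      (fun r s => ¬ rowLT s r) (fun k => w (t - k)) where
  ne_zero := qq_ne_zero
  same k hk a ha b hb hab := by
    rw [Finset.mem_Icc] at ha hb
    by_cases ht' : 1 ≤ t
    · exact h.same _ _ _ (by omega) (by omega) ha.1 hab hb.2
    · omega
  pos k hk r hr s hs hrs := by
    rw [Finset.mem_Icc] at hr hs
    push_cast at hs ⊢
    rw [show t - (k : ℤ) = t - (k + 1) + 1 by ring]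
    exact h.adj_neg (by omega) (by omega) hs.1 hs.2 (by omega) (by omega) hrs
  neg k hk r hr s hs hrs := by
    rw [Finset.mem_Icc] at hr hs
    push_cast at hs ⊢
    rw [show t - (k : ℤ) = t - (k + 1) + 1 by ring]
    exact h.adj_pos (by omega) (by omega) hs.1 hs.2 (by omega) (by omega) (not_not.1 hrs)
  far k l hkl hl r hr s hs := by
    rw [Finset.mem_Icc] at hr hs
    exact h.far _ _ _ _ (by omega) (by omega) (by omega) hs.1 hs.2 hr.1 hr.2
  mono _ _ _ := not_rowLT_of_lt

lemma isLadder_descending_neg (h : IsRowFamily n w) {t : ℤ} (ht : t ≤ n) :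
    IsLadder (t - 1).toNat qq⁻¹ (fun k => Finset.Icc (1 - (t - k)) (t - k))
      (fun r s => rowLT (-s) (-r)) (fun k r => w (t - k) (-r)) where
  ne_zero := inv_ne_zero qq_ne_zero
  same k hk a ha b hb hab := by
    rw [Finset.mem_Icc] at ha hb
    by_cases ht' : 1 ≤ t
    · rw [h.same (t - k) (-b) (-a) (by omega) (by omega) (by omega) (by omega) (by omega),
        smul_smul, ← mul_zpow, inv_mul_cancel₀ qq_ne_zero, one_zpow, one_smul]
    · omega
  pos k hk r hr s hs hrs := by
    rw [Finset.mem_Icc] at hr hs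
    push_cast at hs ⊢
    rw [show t - (k : ℤ) = t - (k + 1) + 1 by ring]
    exact h.adj_pos (by omega) (by omega) (by omega) (by omega) (by omega) (by omega) hrs
  neg k hk r hr s hs hrs := by
    rw [Finset.mem_Icc] at hr hs
    push_cast at hs ⊢
    rw [show t - (k : ℤ) = t - (k + 1) + 1 by ring, inv_inv]
    exact h.adj_neg (by omega) (by omega) (by omega) (by omega) (by omega) (by omega) hrs
  far k l hkl hl r hr s hs := by
    rw [Finset.mem_Icc] at hr hs
    exact h.far _ _ _ _ (by omega) (by omega) (by omega) (by omega) (by omega) (by omega) (by omega)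
  mono _ _ _ := rowLT_neg_of_lt

end IsRowFamily

/-! ### Decompositions -/

lemma eq_of_add_of_mul_eq_smul {K A : Type*} [Field K] [Ring A] [Algebra K A] {q : K}
    (hq : q - q⁻¹ ≠ 0) {x y p₁ p₂ p₁' p₂' : A} (hx : x = p₁ + p₂) (h₁ : y * p₁ = q⁻¹ • (p₁ * y))
    (h₂ : y * p₂ = q • (p₂ * y)) (hx' : x = p₁' + p₂') (h₁' : y * p₁' = q⁻¹ • (p₁' * y))
    (h₂' : y * p₂' = q • (p₂' * y)) : p₂ * y = p₂' * y ∧ y * p₁ = y * p₁' := by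
  have hyx : y * x = q⁻¹ • (x * y) + (q - q⁻¹) • (p₂ * y) := by
    rw [hx, mul_add, h₁, h₂, add_mul]
    module
  have hyx' : y * x = q⁻¹ • (x * y) + (q - q⁻¹) • (p₂' * y) := by
    rw [hx', mul_add, h₁', h₂', add_mul]
    module
  have h : p₂ * y = p₂' * y :=
    smul_right_injective _ hq (add_left_cancel (hyx.symm.trans hyx'))
  refine ⟨h, ?_⟩
  rw [← add_right_cancel_iff (a := y * p₂), ← mul_add, ← hx, h₂, h, ← h₂', ← mul_add, ← hx']

lemma decompPM_spec {n : ℕ} {x y p₁ p₂ : Dtorus n} (hx : x = p₁ + p₂)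
    (h₁ : y * p₁ = qq⁻¹ • (p₁ * y)) (h₂ : y * p₂ = qq • (p₂ * y)) :
    (decompPM n y x).2 * y = p₂ * y ∧ y * (decompPM n y x).1 = y * p₁ := by
  have hex : ∃ p : Dtorus n × Dtorus n,
      x = p.1 + p.2 ∧ y * p.1 = qq⁻¹ • (p.1 * y) ∧ y * p.2 = qq • (p.2 * y) :=
    ⟨(p₁, p₂), hx, h₁, h₂⟩
  obtain ⟨hx', h₁', h₂'⟩ : x = (decompPM n y x).1 + (decompPM n y x).2 ∧
      y * (decompPM n y x).1 = qq⁻¹ • ((decompPM n y x).1 * y) ∧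
      y * (decompPM n y x).2 = qq • ((decompPM n y x).2 * y) := by
    rw [decompPM, dif_pos hex]
    exact hex.choose_spec
  exact eq_of_add_of_mul_eq_smul qq_sub_inv_ne_zero hx' h₁' h₂' hx h₁ h₂

/-- The hypotheses under which `G k` is the `k`-th iterated `q`-commutator of the row sums. -/
structure IsQCommutatorSeq {n : ℕ} (N : ℕ) (q β : Kq) (S : ℕ → Finset ℤ) (v : ℕ → ℤ → Dtorus n)
    (G : ℕ → Dtorus n) : Prop where
  zero : G 0 = ∑ s ∈ S 0, v 0 s
  succ : ∀ k < N, G (k + 1) = β • ((∑ s ∈ S (k + 1), v (k + 1) s) * G k -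
    q⁻¹ • (G k * ∑ s ∈ S (k + 1), v (k + 1) s))

namespace IsLadder

variable {n N : ℕ} {β : Kq} {S : ℕ → Finset ℤ} {P : ℤ → ℤ → Prop} {v : ℕ → ℤ → Dtorus n}
  {G : ℕ → Dtorus n}

lemma decompPM_snd_mul (h : IsLadder N qq S P v) (hG : IsQCommutatorSeq N qq β S v G) {k : ℕ}
    (hk : k < N) {s : ℤ} (hs : s ∈ S (k + 1)) :
    (decompPM n (v (k + 1) s) (G k)).2 * v (k + 1) s =
      (β * (qq - qq⁻¹)) ^ k • pathEnd S P v (k + 1) s := by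
  rw [(decompPM_spec (p₁ := (β * (qq - qq⁻¹)) ^ k • pathOff S P v k s)
    (p₂ := (β * (qq - qq⁻¹)) ^ k • pathTo S P v k s) ?_ ?_ ?_).1, pathEnd_succ, smul_mul_assoc]
  · rw [h.eq_smul_sum_pathEnd hG.zero hG.succ hk.le, ← smul_add, add_comm (pathOff _ _ _ _ _),
      pathTo_add_pathOff]
  · rw [mul_smul_comm, h.mul_pathOff hk hs, smul_mul_assoc, smul_comm]
  · rw [mul_smul_comm, h.mul_pathTo hk hs, smul_mul_assoc, smul_comm]

lemma mul_decompPM_fst (h : IsLadder N qq⁻¹ S P v) (hG : IsQCommutatorSeq N qq⁻¹ β S v G) {k : ℕ}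
    (hk : k < N) {s : ℤ} (hs : s ∈ S (k + 1)) :
    v (k + 1) s * (decompPM n (v (k + 1) s) (G k)).1 =
      (β * (qq⁻¹ - qq⁻¹⁻¹)) ^ k • (v (k + 1) s * pathTo S P v k s) := by
  rw [(decompPM_spec (p₁ := (β * (qq⁻¹ - qq⁻¹⁻¹)) ^ k • pathTo S P v k s)
    (p₂ := (β * (qq⁻¹ - qq⁻¹⁻¹)) ^ k • pathOff S P v k s) ?_ ?_ ?_).2, mul_smul_comm]
  · rw [h.eq_smul_sum_pathEnd hG.zero hG.succ hk.le, ← smul_add, pathTo_add_pathOff]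
  · rw [mul_smul_comm, h.mul_pathTo hk hs, smul_mul_assoc, smul_comm]
  · rw [mul_smul_comm, h.mul_pathOff hk hs, smul_mul_assoc, smul_comm, inv_inv]

lemma decompPM_snd_mul_q_commute (h : IsLadder N qq S P v) (hG : IsQCommutatorSeq N qq β S v G)
    {k : ℕ} (hk : k < N) {a b : ℤ} (ha : a ∈ S (k + 1)) (hb : b ∈ S (k + 1)) (hab : a < b) :
    (decompPM n (v (k + 1) a) (G k)).2 * v (k + 1) a *
        ((decompPM n (v (k + 1) b) (G k)).2 * v (k + 1) b) =
      qq ^ (-2 : ℤ) • ((decompPM n (v (k + 1) b) (G k)).2 * v (k + 1) b *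
        ((decompPM n (v (k + 1) a) (G k)).2 * v (k + 1) a)) := by
  rw [h.decompPM_snd_mul hG hk ha, h.decompPM_snd_mul hG hk hb, smul_mul_smul_comm,
    smul_mul_smul_comm, h.pathEnd_mul_pathEnd hk ha hb hab, smul_comm]

end IsLadder

lemma mul_q_commute_of_pathTo {K A : Type*} [Field K] [Ring A] [Algebra K A] {c : K}
    {u u' w w' d d' y y' : A} (huw : u * w * (u' * w') = c • (u' * w' * (u * w)))
    (hud : Commute u' d) (hud' : Commute u d') (hy : d * w' = w' * y) (hy' : d' * w = w * y')
    (hyy : y * d' = y' * d) :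
    u * (w * d) * (u' * (w' * d')) = c • (u' * (w' * d') * (u * (w * d))) :=
  calc u * (w * d) * (u' * (w' * d'))
      = u * w * (d * u') * (w' * d') := by simp only [mul_assoc]
    _ = u * w * u' * (d * w') * d' := by rw [← hud.eq]; simp only [mul_assoc]
    _ = u * w * (u' * w') * (y * d') := by rw [hy]; simp only [mul_assoc]
    _ = c • (u' * w' * u * (w * y') * d) := by
      rw [huw, hyy, smul_mul_assoc]; simp only [mul_assoc]
    _ = c • (u' * w' * (u * d') * w * d) := by rw [← hy']; simp only [mul_assoc]
    _ = c • (u' * (w' * d') * (u * (w * d))) := by rw [hud'.eq]; simp only [mul_assoc]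

/-! ### The quantum root vectors -/

lemma smul_sub_smul_eq_neg {K A : Type*} [Field K] [Ring A] [Algebra K A] {q : K} (hq : q ≠ 0)
    (c : K) (x y : A) : c • (x - q • y) = (-(c * q)) • (y - q⁻¹ • x) := by
  match_scalars <;> field_simp

lemma q_commutator_assoc {K A : Type*} [Field K] [Ring A] [Algebra K A] (c q : K) {x y : A}
    (z : A) (h : Commute x y) :
    c • (c • (x * z - q • (z * x)) * y - q • (y * c • (x * z - q • (z * x)))) =
      c • (x * c • (z * y - q • (y * z)) - q • (c • (z * y - q • (y * z)) * x)) := by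
  have e₁ : y * (x * z) = x * (y * z) := by rw [← mul_assoc, ← h.eq, mul_assoc]
  have e₂ : z * (y * x) = z * (x * y) := by rw [h.eq]
  simp only [mul_sub, sub_mul, mul_smul_comm, smul_mul_assoc, mul_assoc, e₁, e₂]
  module

lemma EEaux_isQCommutatorSeq (n N : ℕ) (i : ℤ) :
    IsQCommutatorSeq N qq (-((qq - qq⁻¹)⁻¹ * qq)) (fun k => Finset.Icc (-(i + k)) (i + k - 1))
      (fun k => ww n (i + k)) (EEaux n i) where
  zero := by simp [EEaux, Ev]
  succ k _ := by
    have : EEaux n i (k + 1) = (qq - qq⁻¹)⁻¹ •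
      (EEaux n i k * Ev n (i + k + 1) - qq • (Ev n (i + k + 1) * EEaux n i k)) := rfl
    rw [this, Ev, add_assoc]
    push_cast
    generalize ∑ r ∈ _, ww n _ r = V
    exact smul_sub_smul_eq_neg qq_ne_zero _ _ _

lemma FFaux_isQCommutatorSeq (n N : ℕ) (i : ℤ) :
    IsQCommutatorSeq N qq (qq - qq⁻¹)⁻¹
      (fun k => Finset.Icc (-(th n i - k)) (th n i - k - 1))
      (fun k => mm n (th n i - k)) (FFaux n i) where
  zero := by simp [FFaux, Fv]
  succ k _ := by
    have : FFaux n i (k + 1) = (qq - qq⁻¹)⁻¹ •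
      (Fv n (i + k + 1) * FFaux n i k - qq⁻¹ • (FFaux n i k * Fv n (i + k + 1))) := rfl
    rw [this, Fv, show th n (i + k + 1) = th n i - (k + 1 : ℕ) by unfold th; push_cast; ring]

lemma isRowFamily_ww (n : ℕ) : IsRowFamily n (ww n) :=
  ww_eq_rowMonomial n ▸ (isRowPairing_V n).isRowFamily

lemma isRowFamily_mm (n : ℕ) : IsRowFamily n (mm n) :=
  mm_eq_rowMonomial n ▸ (isRowPairing_Lam n).isRowFamily

lemma Ev_commute (n : ℕ) {i j : ℤ} (hi : 1 ≤ i) (hij : i + 1 < j) (hj : j ≤ n) :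
    Commute (Ev n i) (Ev n j) :=
  Commute.sum_left _ _ _ fun r hr => Commute.sum_right _ _ _ fun s hs => by
    rw [Finset.mem_Icc] at hr hs
    exact (isRowFamily_ww n).far i j r s hi hij hj hr.1 hr.2 hs.1 hs.2

/-- The recursion for the quantum root vectors lowering the first index. -/
lemma EEaux_succ_eq_left (n k : ℕ) (i : ℤ) (hi : 1 ≤ i) (hk : i + k + 1 ≤ n) :
    EEaux n i (k + 1) = (qq - qq⁻¹)⁻¹ •
      (Ev n i * EEaux n (i + 1) k - qq • (EEaux n (i + 1) k * Ev n i)) := by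
  induction k with
  | zero => simp [EEaux]
  | succ k ih =>
    have hr : EEaux n i (k + 1 + 1) = (qq - qq⁻¹)⁻¹ • (EEaux n i (k + 1) * Ev n (i + k + 2) -
        qq • (Ev n (i + k + 2) * EEaux n i (k + 1))) := by
      conv_lhs => rw [EEaux]
      rw [show i + ((k + 1 : ℕ) : ℤ) + 1 = i + k + 2 by push_cast; ring]
    have hr' : EEaux n (i + 1) (k + 1) = (qq - qq⁻¹)⁻¹ • (EEaux n (i + 1) k * Ev n (i + k + 2) -
        qq • (Ev n (i + k + 2) * EEaux n (i + 1) k)) := by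
      conv_lhs => rw [EEaux]
      rw [show i + 1 + (k : ℤ) + 1 = i + k + 2 by ring]
    push_cast at hk
    have hc := Ev_commute n (j := i + k + 2) hi (by omega) (by omega)
    rw [hr, ih (by omega), hr']
    exact q_commutator_assoc (qq - qq⁻¹)⁻¹ qq _ hc

lemma EEaux_isQCommutatorSeq_left (n : ℕ) {t : ℤ} (ht : t ≤ n) :
    IsQCommutatorSeq (t - 1).toNat qq⁻¹ (qq - qq⁻¹)⁻¹ (fun k => Finset.Icc (1 - (t - k)) (t - k))
      (fun k r => ww n (t - k) (-r)) (fun k => EEaux n (t - k) k) := by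
  have hEv : ∀ i : ℤ, ∑ r ∈ Finset.Icc (1 - i) i, ww n i (-r) = Ev n i := fun i => by
    refine Finset.sum_nbij' (fun r => -r) (fun r => -r) ?_ ?_ ?_ ?_ ?_ <;>
      simp only [Finset.mem_Icc] <;> intros <;> first | omega | trivial
  refine ⟨?_, fun k hk => ?_⟩
  · rw [hEv]
    rfl
  · rw [hEv, EEaux_succ_eq_left _ _ _ (by omega) (by omega), inv_inv,
      show t - ((k + 1 : ℕ) : ℤ) + 1 = t - k by push_cast; ring]

/-- `q`-commutation relations between the summands of the path
decompositions of the quantum root vectors. -/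
theorem statement10 (n : ℕ) (hn : 1 ≤ n) :
    -- (a)
    (∀ i j a b : ℤ, 1 ≤ i → i < j → j ≤ (n : ℤ) → -j ≤ a → a < b → b ≤ j - 1 →
      ((Eup n i (j - 1) a).2 * ww n j a) * ((Eup n i (j - 1) b).2 * ww n j b)
        = (qq ^ (-2 : ℤ)) •
          (((Eup n i (j - 1) b).2 * ww n j b) * ((Eup n i (j - 1) a).2 * ww n j a))) ∧
    -- (b)
    (∀ i j a b : ℤ, 1 ≤ i → i < j → j ≤ (n : ℤ) → -(th n j) ≤ a → a < b → b ≤ th n j - 1 →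
      ((Fup n i (j - 1) a).2 * mm n (th n j) a) * ((Fup n i (j - 1) b).2 * mm n (th n j) b)
        = (qq ^ (-2 : ℤ)) •
          (((Fup n i (j - 1) b).2 * mm n (th n j) b)
            * ((Fup n i (j - 1) a).2 * mm n (th n j) a))) ∧
    -- (c)
    (∀ i j k a b : ℤ, 1 ≤ i → i < j → j < k → k ≤ (n : ℤ) → -j ≤ a → a < b → b ≤ j - 1 →
      ((Eup n i (j - 1) a).2 * ww n j a * (Edown n (j + 1) k a).1)
          * ((Eup n i (j - 1) b).2 * ww n j b * (Edown n (j + 1) k b).1)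
        = (qq ^ (-2 : ℤ)) •
          (((Eup n i (j - 1) b).2 * ww n j b * (Edown n (j + 1) k b).1)
            * ((Eup n i (j - 1) a).2 * ww n j a * (Edown n (j + 1) k a).1))) := by
  refine ⟨fun i j a b hi hij hj ha hab hb => ?_, fun i j a b hi hij hj ha hab hb => ?_,
    fun i j t a b hi hij hjt ht ha hab hb => ?_⟩
  · obtain ⟨k, rfl⟩ : ∃ k : ℕ, j = i + ((k + 1 : ℕ) : ℤ) := ⟨(j - i - 1).toNat, by omega⟩
    have key := ((isRowFamily_ww n).isLadder_ascending hi (by omega)).decompPM_snd_mul_q_commute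
      (EEaux_isQCommutatorSeq n _ i) (k := k) (a := a) (b := b) (by omega)
      (Finset.mem_Icc.2 ⟨ha, by omega⟩) (Finset.mem_Icc.2 ⟨by omega, hb⟩) hab
    have hk : (i + ((k + 1 : ℕ) : ℤ) - 1 - i).toNat = k := by omega
    simpa only [Eup, EE, hk, sub_add_cancel] using key
  · obtain ⟨k, rfl⟩ : ∃ k : ℕ, j = i + ((k + 1 : ℕ) : ℤ) := ⟨(j - i - 1).toNat, by omega⟩
    have hth : th n (i + ((k + 1 : ℕ) : ℤ)) = th n i - ((k + 1 : ℕ) : ℤ) := by unfold th; ring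
    rw [hth] at ha hb
    have hti : th n i = n + 1 - i := rfl
    have key := ((isRowFamily_mm n).isLadder_descending (t := th n i) (by omega)
      ).decompPM_snd_mul_q_commute (FFaux_isQCommutatorSeq n _ i) (k := k) (a := a) (b := b)
      (by omega) (Finset.mem_Icc.2 ⟨ha, by omega⟩) (Finset.mem_Icc.2 ⟨by omega, hb⟩) hab
    have hk : (i + ((k + 1 : ℕ) : ℤ) - 1 - i).toNat = k := by omega
    simpa only [Fup, FF, hk, sub_add_cancel, hth] using key
  · obtain ⟨k, hk⟩ : ∃ k : ℕ, j = i + ((k + 1 : ℕ) : ℤ) := ⟨(j - i - 1).toNat, by omega⟩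
    obtain ⟨m, hm⟩ : ∃ m : ℕ, j = t - ((m + 1 : ℕ) : ℤ) := ⟨(t - j - 1).toNat, by omega⟩
    have hU := (isRowFamily_ww n).isLadder_ascending hi (by omega)
    have hD := (isRowFamily_ww n).isLadder_descending_neg ht
    have hk' : (j - 1 - i).toNat = k := by omega
    have hm' : (t - (j + 1)).toNat = m := by omega
    have hkN : k < (n - i).toNat := by omega
    have hmN : m < (t - 1).toNat := by omega
    have key₁ : ∀ s, -j ≤ s → s ≤ j - 1 → _ := fun s hs hs' =>
      hU.decompPM_snd_mul (EEaux_isQCommutatorSeq n _ i) hkN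
        (Finset.mem_Icc.2 ⟨hk ▸ hs, hk ▸ hs'⟩)
    have key₂ : ∀ s, -j ≤ s → s ≤ j - 1 → _ := fun s hs hs' =>
      hD.mul_decompPM_fst (EEaux_isQCommutatorSeq_left n ht) hmN (s := -s)
        (Finset.mem_Icc.2 ⟨hm ▸ (by omega : 1 - j ≤ -s), hm ▸ (by omega : -s ≤ j)⟩)
    obtain ⟨Y, Y', hY, hY', hYY⟩ := hD.exists_pathTo_mul hmN
      (fun r hr r' hr' => hD.pathEnd_mul_pathEnd hmN.le hr hr')
      (a := -a) (b := -b)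
      (Finset.mem_Icc.2 ⟨hm ▸ (by omega : 1 - j ≤ -a), hm ▸ (by omega : -a ≤ j)⟩)
      (Finset.mem_Icc.2 ⟨hm ▸ (by omega : 1 - j ≤ -b), hm ▸ (by omega : -b ≤ j)⟩)
    have hUU := hU.pathEnd_mul_pathEnd (k := k + 1) hkN
      (Finset.mem_Icc.2 ⟨hk ▸ ha, hk ▸ (by omega : a ≤ j - 1)⟩)
      (Finset.mem_Icc.2 ⟨hk ▸ (by omega : -j ≤ b), hk ▸ hb⟩) hab
    let U := pathTo (fun k : ℕ => Finset.Icc (-(i + k)) (i + k - 1)) rowLT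
      (fun k => ww n (i + k)) k
    let D := pathTo (fun k : ℕ => Finset.Icc (1 - (t - k)) (t - k))
      (fun r s => rowLT (-s) (-r)) (fun k r => ww n (t - k) (-r)) m
    have hUD : ∀ s s', Commute (U s) (D s') := by
      refine fun s s' => commute_pathTo (fun l hl r hr => (commute_pathTo (fun l' hl' r' hr' =>
        ((isRowFamily_ww n).far _ _ _ _ ?_ ?_ ?_ ?_ ?_ ?_ ?_).symm) s).symm) s' <;>
      rw [Finset.mem_Icc] at hr hr' <;> omega
    have key := mul_q_commute_of_pathTo (by simpa only [pathEnd_succ, ← hk] using hUU)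
      (hUD b (-a)) (hUD a (-b)) (by simpa only [neg_neg, ← hm] using hY)
      (by simpa only [neg_neg, ← hm] using hY') hYY
    obtain ⟨c, hprod⟩ : ∃ c : Kq, ∀ s, -j ≤ s → s ≤ j - 1 →
        (Eup n i (j - 1) s).2 * ww n j s * (Edown n (j + 1) t s).1 =
          c • (U s * (ww n j s * D (-s))) := by
      refine ⟨(-((qq - qq⁻¹)⁻¹ * qq) * (qq - qq⁻¹)) ^ k * ((qq - qq⁻¹)⁻¹ * (qq⁻¹ - qq⁻¹⁻¹)) ^ m,
        fun s hs hs' => ?_⟩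
      have h₁ := key₁ s hs hs'
      have h₂ := key₂ s hs hs'
      simp only [pathEnd_succ, neg_neg, ← hk, ← hm] at h₁ h₂
      rw [show t - (m : ℤ) = j + 1 by omega] at h₂
      rw [Eup, Edown, EE, EE, hk', hm', sub_add_cancel, add_sub_cancel_right, h₁, smul_mul_assoc,
        mul_assoc, h₂, mul_smul_comm, smul_smul]
    rw [hprod a ha (by omega), hprod b (by omega) hb, smul_mul_smul_comm, smul_mul_smul_comm, key,
      smul_comm]

end
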